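/- Let F = ℚ(√d) with d ≥ 6 squarefree and let H be a totally definite quaternion F-algebra. If H is not F-isomorphic to any of the quaternion algebras (−1,−1/F), (−1,−3/F), (−1,−ε/F), (−ε,−3/F) (the last two arising only when Nm_{F/ℚ}(ε) = 1), then for every O_F-order 𝒪 in H the reduced unit group 𝒪^×/O_F^× is cyclic. In particular this holds whenever the discriminant of H does not divide 6O_F. -/

import Mathlib

open NumberField Quaternion

noncomputable section

namespace QuatPaper

variable (F : Type) [Field F] [NumberField F]

def scalarSet (H : Type) [Ring H] [Algebra F H] : Set H :=
  Set.range fun r : 𝓞 F => algebraMap F H (algebraMap (𝓞 F) F r)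

def IsOrder {H : Type} [Ring H] [Algebra F H] (O : Subring H) : Prop :=
  scalarSet F H ⊆ ↑O ∧ O.toAddSubgroup.FG ∧ Submodule.span F (O : Set H) = ⊤

def IsMaximalOrder {H : Type} [Ring H] [Algebra F H] (O : Subring H) : Prop :=
  IsOrder F O ∧ ∀ O' : Subring H, IsOrder F O' → O ≤ O' → O' = O

def IsScalarUnit {H : Type} [Ring H] [Algebra F H] {O : Subring H} (u : (↥O)ˣ) : Prop :=
  ∃ r : (𝓞 F)ˣ, ((u : ↥O) : H) = algebraMap F H (algebraMap (𝓞 F) F ↑r)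

def RedUnitIso {H : Type} [Ring H] [Algebra F H] (O : Subring H) (G : Type*) [Group G] : Prop :=
  ∃ φ : (↥O)ˣ →* G, Function.Surjective φ ∧ ∀ u, φ u = 1 ↔ IsScalarUnit F u

def IsConjugate {H : Type} [Ring H] (x : Hˣ) (O O' : Subring H) : Prop :=
  ∀ y : H, y ∈ O ↔ (x : H) * y * ((x⁻¹ : Hˣ) : H) ∈ O'

def ConjRel {H : Type} [Ring H] (O O' : Subring H) : Prop :=
  ∃ x : Hˣ, IsConjugate x O O'

def typeNum (H : Type) [Ring H] [Algebra F H] (G : Type*) [Group G] : ℕ :=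
  Nat.card (Quot fun O O' : {O : Subring H // IsMaximalOrder F O ∧ RedUnitIso F O G} =>
    ConjRel O.1 O'.1)

def IsQuatAlg (H : Type) [Ring H] [Algebra F H] : Prop :=
  ∃ a b : F, a ≠ 0 ∧ b ≠ 0 ∧ Nonempty (H ≃ₐ[F] ℍ[F, a, b])

def TotallyDefinite (H : Type) [Ring H] [Algebra F H] : Prop :=
  ∀ σ : F →+* ℝ,
    letI : Algebra F ℝ := σ.toAlgebra
    ∀ x : TensorProduct F ℝ H, x ≠ 0 → IsUnit x

/-- The reduced unit group `O^×/O_F^×` of the order `O` is cyclic: some unit `g`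
generates it modulo scalars. -/
def RedUnitCyclic {H : Type} [Ring H] [Algebra F H] (O : Subring H) : Prop :=
  ∃ g : (↥O)ˣ, ∀ u : (↥O)ˣ, ∃ n : ℤ, ∃ r : (𝓞 F)ˣ,
    ((u : ↥O) : H) =
      algebraMap F H (algebraMap (𝓞 F) F ↑r) * (((g ^ n : (↥O)ˣ) : ↥O) : H)

section QuadraticField

variable {F}

theorem sq_ne_natCast_of_squarefree {d : ℕ} (hd : 2 ≤ d) (hdsf : Squarefree d) (q : ℚ) :
    q ^ 2 ≠ d := by
  intro h
  have hs : IsSquare (d : ℚ) := ⟨q, by rw [← h, sq]⟩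
  obtain ⟨k, hk⟩ := Rat.isSquare_natCast_iff.mp hs
  have := Nat.isUnit_iff.mp (hdsf k ⟨1, by rw [hk, mul_one]⟩)
  subst this
  omega

theorem exists_eq_add_mul {d : ℕ} {sqrtd : F} (hsqrtd : sqrtd ^ 2 = (d : F))
    (hgen : Algebra.adjoin ℚ {sqrtd} = ⊤) (x : F) : ∃ a b : ℚ, x = a + b * sqrtd := by
  have hx : x ∈ Algebra.adjoin ℚ {sqrtd} := by rw [hgen]; trivial
  induction hx using Algebra.adjoin_induction with
  | mem x hx => exact ⟨0, 1, by rw [Set.mem_singleton_iff.mp hx]; simp⟩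
  | algebraMap r => exact ⟨r, 0, by simp⟩
  | add x y _ _ hx hy =>
    obtain ⟨a, b, rfl⟩ := hx
    obtain ⟨a', b', rfl⟩ := hy
    exact ⟨a + a', b + b', by push_cast; ring⟩
  | mul x y _ _ hx hy =>
    obtain ⟨a, b, rfl⟩ := hx
    obtain ⟨a', b', rfl⟩ := hy
    refine ⟨a * a' + b * b' * d, a * b' + b * a', ?_⟩
    push_cast
    rw [← hsqrtd]
    ring

theorem exists_conj_embedding {d : ℕ} (hd : 2 ≤ d) (hdsf : Squarefree d) {sqrtd : F}
    (hsqrtd : sqrtd ^ 2 = (d : F)) (hgen : Algebra.adjoin ℚ {sqrtd} = ⊤) (σ : F →+* ℝ) :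
    ∃ τ : F →+* ℝ, τ sqrtd = -σ sqrtd := by
  have hirr : Irreducible (Polynomial.X ^ 2 - Polynomial.C (d : ℚ)) := by
    refine (X_pow_sub_C_irreducible_iff_of_prime Nat.prime_two).mpr fun q => ?_
    exact sq_ne_natCast_of_squarefree hd hdsf q
  have hmin : Polynomial.X ^ 2 - Polynomial.C (d : ℚ) = minpoly ℚ sqrtd :=
    minpoly.eq_of_irreducible_of_monic hirr (by simp [hsqrtd])
      (Polynomial.monic_X_pow_sub_C _ two_ne_zero)
  have hroot : Polynomial.aeval (-σ sqrtd) (minpoly ℚ sqrtd) = 0 := by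
    rw [← hmin]
    rw [map_sub, map_pow, Polynomial.aeval_X, neg_sq, ← map_pow, hsqrtd]
    simp
  let f := Algebra.adjoin.liftSingleton ℚ sqrtd (-σ sqrtd) hroot
  refine ⟨(f.comp (Subalgebra.equivOfEq ⊤ _ hgen.symm).toAlgHom).toRingHom.comp
    (Subalgebra.topEquiv (R := ℚ) (A := F)).symm.toAlgHom.toRingHom, ?_⟩
  change f ⟨sqrtd, _⟩ = _
  let e := AlgEquiv.adjoinSingletonEquivAdjoinRootMinpoly ℚ sqrtd
  have he : e ⟨sqrtd, Algebra.self_mem_adjoin_singleton ℚ sqrtd⟩ = AdjoinRoot.root _ :=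
    (e.symm_apply_eq.mp (Subtype.ext AdjoinRoot.Minpoly.coe_toAdjoin_mk_X)).symm
  exact (congrArg (AdjoinRoot.liftAlgHom (minpoly ℚ sqrtd) (Algebra.ofId ℚ ℝ) _ hroot) he).trans
    (AdjoinRoot.liftAlgHom_root _ _ _ _)

theorem eq_natCast_of_isIntegral_of_bounded {d : ℕ} (hd : 6 ≤ d) (hdsf : Squarefree d) {sqrtd : F}
    (hsqrtd : sqrtd ^ 2 = (d : F)) (hgen : Algebra.adjoin ℚ {sqrtd} = ⊤) (σ : F →+* ℝ)
    {x : F} (hx : IsIntegral ℤ x) (hb : ∀ τ : F →+* ℝ, 0 ≤ τ x ∧ τ x ≤ 4) :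
    ∃ k : ℕ, k ≤ 4 ∧ x = k := by
  obtain ⟨τ, hτ⟩ := exists_conj_embedding (by omega) hdsf hsqrtd hgen σ
  obtain ⟨a, b, rfl⟩ := exists_eq_add_mul hsqrtd hgen x
  have hσx := hb σ
  have hτx := hb τ
  have iσ : IsIntegral ℤ (σ (a + b * sqrtd)) := hx.map σ.toIntAlgHom
  have iτ : IsIntegral ℤ (τ (a + b * sqrtd)) := hx.map τ.toIntAlgHom
  have hs2 : (σ sqrtd) ^ 2 = d := by rw [← map_pow, hsqrtd, map_natCast]
  simp only [map_add, map_mul, map_ratCast, hτ] at hσx hτx iσ iτ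
  have key : ∀ q : ℚ, IsIntegral ℤ (q : ℝ) → ∃ m : ℤ, q = m := fun q hq => by
    have : IsIntegral ℤ (algebraMap ℚ ℝ q) := hq
    rw [isIntegral_algebraMap_iff (algebraMap ℚ ℝ).injective] at this
    obtain ⟨m, hm⟩ := IsIntegrallyClosed.isIntegral_iff.mp this
    exact ⟨m, hm.symm⟩
  obtain ⟨m, hm⟩ := key (2 * a) (by
    have := iσ.add iτ
    rwa [show ((2 * a : ℚ) : ℝ) = a + b * σ sqrtd + (a + b * -σ sqrtd) by push_cast; ring])
  obtain ⟨N, hN⟩ := key (a ^ 2 - d * b ^ 2) (by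
    have := iσ.mul iτ
    rwa [show ((a ^ 2 - d * b ^ 2 : ℚ) : ℝ) = (a + b * σ sqrtd) * (a + b * -σ sqrtd) by
      push_cast; rw [← hs2]; ring])
  have hdq : (d : ℚ) * (2 * b) ^ 2 = ((m ^ 2 - 4 * N : ℤ) : ℚ) := by
    push_cast; rw [← hN, ← hm]; ring
  have hD : m ^ 2 - 4 * N ≤ 16 := by
    have : (d : ℝ) * (2 * b) ^ 2 ≤ 16 := by rw [← hs2]; nlinarith
    have h2 : ((m ^ 2 - 4 * N : ℤ) : ℝ) ≤ 16 := by
      rw [← Rat.cast_intCast, ← hdq]; push_cast; exact this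
    exact_mod_cast h2
  have hm0 : 0 ≤ m ∧ m ≤ 8 := by
    have h2 : (m : ℝ) = 2 * a := by exact_mod_cast hm.symm
    constructor
    · have : (0 : ℝ) ≤ m := by linarith
      exact_mod_cast this
    · have : (m : ℝ) ≤ 8 := by linarith
      exact_mod_cast this
  obtain ⟨q, hq⟩ : ∃ q : ℤ, 2 * b = q := by
    set c := 2 * b
    have hc : (d : ℤ) * c.num ^ 2 = (m ^ 2 - 4 * N) * c.den ^ 2 := by
      have h0 : (c.den : ℚ) ≠ 0 := by exact_mod_cast c.den_ne_zero
      have : (d : ℚ) * c.num ^ 2 = ((m ^ 2 - 4 * N : ℤ) : ℚ) * c.den ^ 2 := by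
        rw [← hdq]
        nth_rw 2 [← Rat.num_div_den c]
        field_simp
      exact_mod_cast this
    have hcop : IsCoprime ((c.den : ℤ) ^ 2) (c.num ^ 2) :=
      (Int.isCoprime_iff_gcd_eq_one.mpr (by
        rw [Int.gcd_comm]; exact c.reduced)).pow
    have hdvd : ((c.den : ℤ) ^ 2) ∣ d := by
      refine hcop.dvd_of_dvd_mul_right ?_
      exact ⟨m ^ 2 - 4 * N, by rw [hc]; ring⟩
    have hdvd' : c.den * c.den ∣ d := by
      rw [← sq]; exact_mod_cast hdvd
    have hden := Nat.isUnit_iff.mp (hdsf _ hdvd')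
    exact ⟨c.num, (Rat.den_eq_one_iff c).mp hden |>.symm⟩
  have hdq' : (d : ℤ) * q ^ 2 = m ^ 2 - 4 * N := by
    rw [hq] at hdq
    exact_mod_cast hdq
  have hq0 : q = 0 := by
    by_contra hne
    have h1 : 1 ≤ q ^ 2 := by have := sq_pos_of_ne_zero hne; omega
    have h3 : q ^ 2 < 4 := by nlinarith [(by exact_mod_cast hd : (6 : ℤ) ≤ d)]
    have hq1 : q ^ 2 = 1 := by
      have : q < 2 := by nlinarith
      have : -2 < q := by nlinarith
      interval_cases q <;> simp_all
    rw [hq1, mul_one] at hdq'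
    have hd16 : d ≤ 16 := by omega
    have hσb : (d : ℝ) = (2 * b * σ sqrtd) ^ 2 := by
      rw [mul_pow, hs2]
      have : ((2 * b) ^ 2 : ℝ) = 1 := by
        have h2 : ((2 * b : ℚ) : ℝ) ^ 2 = 1 := by rw [hq]; exact_mod_cast hq1
        push_cast at h2; exact h2
      rw [this, one_mul]
    have hma : (m : ℝ) = 2 * a := by exact_mod_cast hm.symm
    have hle1 : (d : ℝ) ≤ m ^ 2 := by
      rw [hσb, hma]; nlinarith
    have hle2 : (d : ℝ) ≤ (8 - m) ^ 2 := by
      rw [hσb, hma]; nlinarith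
    have hle1' : (d : ℤ) ≤ m ^ 2 := by exact_mod_cast hle1
    have hle2' : (d : ℤ) ≤ (8 - m) ^ 2 := by exact_mod_cast hle2
    have n8 : ¬Squarefree 8 := by decide +kernel
    have n9 : ¬Squarefree 9 := by decide +kernel
    have n12 : ¬Squarefree 12 := by decide +kernel
    have n16 : ¬Squarefree 16 := by decide +kernel
    obtain ⟨hm1, hm2⟩ := hm0
    interval_cases m <;> interval_cases d <;> first | omega | contradiction
  have hb0 : b = 0 := by
    rw [hq0] at hq
    push_cast at hq
    linarith
  subst hb0
  rw [hq0] at hdq'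
  obtain ⟨k, hk⟩ : Even m := by
    have : Even (m ^ 2) := ⟨2 * N, by linarith⟩
    exact (Int.even_pow.mp this).1
  have ha : a = k := by
    rw [hk] at hm; push_cast at hm; linarith
  refine ⟨k.toNat, by omega, ?_⟩
  have : ((k.toNat : ℤ) : F) = (k : F) := by rw [Int.toNat_of_nonneg (by omega)]
  rw [ha]
  push_cast at this ⊢
  rw [this]
  simp

theorem exists_eq_sq_or_eq_mul_sq {F : Type} [Field F] {σ : F →+* ℝ} {ε : (𝓞 F)ˣ}
    (hε : 1 < σ (algebraMap (𝓞 F) F ↑ε))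
    (hεfund : ∀ u : (𝓞 F)ˣ, 1 < σ (algebraMap (𝓞 F) F ↑u) →
      σ (algebraMap (𝓞 F) F ↑ε) ≤ σ (algebraMap (𝓞 F) F ↑u))
    (n : (𝓞 F)ˣ) (hn : 0 < σ (algebraMap (𝓞 F) F ↑n)) :
    ∃ w : F, w ≠ 0 ∧ (algebraMap (𝓞 F) F ↑n = 1 * w ^ 2 ∨
      algebraMap (𝓞 F) F ↑n = algebraMap (𝓞 F) F ↑ε * w ^ 2) := by
  let f : (𝓞 F)ˣ →* Fˣ := Units.map (algebraMap (𝓞 F) F).toMonoidHom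
  let g : (𝓞 F)ˣ →* ℝˣ := (Units.map σ.toMonoidHom).comp f
  have hg : ∀ u, (g u : ℝ) = σ (algebraMap (𝓞 F) F ↑u) := fun u => rfl
  have hf : ∀ u, (f u : F) = algebraMap (𝓞 F) F ↑u := fun u => rfl
  obtain ⟨k, hk1, hk2⟩ := exists_mem_Ico_zpow hn hε
  rw [← hg, ← hg] at hk1 hk2
  rw [← hg] at hn hε
  have hpos : (0 : ℝ) < (g ε : ℝ) ^ k := zpow_pos (by linarith) k
  have hnk : n = ε ^ k := by
    have hval : (g (n * (ε ^ k)⁻¹) : ℝ) = g n / (g ε : ℝ) ^ k := by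
      simp [map_mul, map_inv, map_zpow, div_eq_mul_inv]
    have h1 : 1 ≤ (g (n * (ε ^ k)⁻¹) : ℝ) := by
      rw [hval, le_div_iff₀ hpos]; linarith
    have h2 : (g (n * (ε ^ k)⁻¹) : ℝ) < g ε := by
      rw [hval, div_lt_iff₀ hpos, mul_comm, ← zpow_add_one₀ (by linarith)]; exact hk2
    have h3 : (g (n * (ε ^ k)⁻¹) : ℝ) = 1 := by
      by_contra hne
      exact absurd (hεfund _ (lt_of_le_of_ne h1 (Ne.symm hne))) (not_le.mpr h2)
    rw [← mul_inv_eq_one]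
    apply Units.ext
    apply RingOfIntegers.ext
    apply σ.injective
    rw [hg] at h3
    rw [h3]; simp
  obtain ⟨j, hj | hj⟩ := Int.even_or_odd' k
  · refine ⟨(f (ε ^ j) : Fˣ), Units.ne_zero _, Or.inl ?_⟩
    rw [← hf, hnk, hj, one_mul, ← Units.val_pow_eq_pow_val, ← map_pow, ← zpow_natCast, ← zpow_mul,
      mul_comm]
    rfl
  · refine ⟨(f (ε ^ j) : Fˣ), Units.ne_zero _, Or.inr ?_⟩
    rw [← hf, ← hf, hnk, hj, ← Units.val_pow_eq_pow_val, ← map_pow, ← zpow_natCast, ← zpow_mul,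
      ← Units.val_mul, ← map_mul, ← zpow_one_add, mul_comm, add_comm]
    rfl

end QuadraticField

section LocalSplitting

theorem exists_sq_eq_of_norm_sq_sub_lt_one {L : Type*} [NormedField L] [CompleteSpace L]
    [IsUltrametricDist L] {c x : L} (h2 : ‖(2 : L)‖ = 1) (hx : ‖x‖ = 1) (hc : ‖x ^ 2 - c‖ < 1) :
    ∃ r : L, r ^ 2 = c := by
  set δ := ‖x ^ 2 - c‖
  have hδ0 : 0 ≤ δ := norm_nonneg _
  have h20 : (2 : L) ≠ 0 := by
    intro h; rw [h, norm_zero] at h2; exact zero_ne_one h2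
  let y : ℕ → L := fun n => Nat.rec x (fun _ z => z - (z ^ 2 - c) / (2 * z)) n
  have hsucc : ∀ n, y (n + 1) = y n - (y n ^ 2 - c) / (2 * y n) := fun n => rfl
  have hstep : ∀ n, ‖y n‖ = 1 → dist (y n) (y (n + 1)) = ‖y n ^ 2 - c‖ := by
    intro n h
    rw [dist_eq_norm, hsucc, sub_sub_cancel, norm_div, norm_mul, h2, h]
    simp
  have hinv : ∀ n, ‖y n‖ = 1 ∧ ‖y n ^ 2 - c‖ ≤ δ ^ (n + 1) := by
    intro n
    induction n with
    | zero => exact ⟨hx, by rw [zero_add, pow_one]; exact le_rfl⟩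
    | succ n ih =>
      obtain ⟨h1, hle⟩ := ih
      have hlt : ‖y n ^ 2 - c‖ < 1 := hle.trans_lt (pow_lt_one₀ hδ0 hc (by omega))
      have hy0 : y n ≠ 0 := by
        intro h; rw [h, norm_zero] at h1; exact zero_ne_one h1
      constructor
      · have hd := hstep n h1
        rw [dist_comm, dist_eq_norm] at hd
        have := IsUltrametricDist.norm_add_eq_max_of_norm_ne_norm
          (x := y (n + 1) - y n) (y := y n) (by rw [hd, h1]; exact hlt.ne)
        rw [sub_add_cancel, hd, h1, max_eq_right hlt.le] at this
        exact this
      · have : y (n + 1) ^ 2 - c = (y n ^ 2 - c) ^ 2 / (2 * y n) ^ 2 := by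
          rw [hsucc]
          field_simp
          ring
        rw [this, norm_div, norm_pow, norm_pow, norm_mul, h2, h1, mul_one, one_pow, div_one]
        calc ‖y n ^ 2 - c‖ ^ 2 ≤ (δ ^ (n + 1)) ^ 2 := by gcongr
          _ = δ ^ (2 * n + 2) := by ring
          _ ≤ δ ^ (n + 1 + 1) := pow_le_pow_of_le_one hδ0 hc.le (by omega)
  have hcau : CauchySeq y := cauchySeq_of_le_geometric δ δ hc fun n => by
    rw [hstep n (hinv n).1, ← pow_succ']
    exact (hinv n).2
  obtain ⟨r, hr⟩ := cauchySeq_tendsto_of_complete hcau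
  refine ⟨r, ?_⟩
  have hlim : Filter.Tendsto (fun n => y n ^ 2 - c) Filter.atTop (nhds (r ^ 2 - c)) :=
    (hr.pow 2).sub_const c
  have hzero : Filter.Tendsto (fun n => y n ^ 2 - c) Filter.atTop (nhds 0) := by
    refine squeeze_zero_norm (fun n => (hinv n).2) ?_
    exact (tendsto_pow_atTop_nhds_zero_of_lt_one hδ0 hc).comp (Filter.tendsto_add_atTop_nat 1)
  exact sub_eq_zero.mp (tendsto_nhds_unique hlim hzero)

variable {F}

open IsDedekindDomain

instance isUltrametricDist_adicCompletion (v : HeightOneSpectrum (𝓞 F)) :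
    IsUltrametricDist (v.adicCompletion F) :=
  IsUltrametricDist.isUltrametricDist_of_forall_norm_add_le_max_norm fun x y => by
    simp only [FinitePlace.norm_def]
    rw [← NNReal.coe_max, NNReal.coe_le_coe,
      ← (WithZeroMulInt.toNNReal_strictMono
        (HeightOneSpectrum.one_lt_absNorm_nnreal v)).monotone.map_max]
    exact (WithZeroMulInt.toNNReal_strictMono
      (HeightOneSpectrum.one_lt_absNorm_nnreal v)).monotone (Valued.v.map_add x y)

theorem exists_adicCompletion_sq_eq (v : HeightOneSpectrum (𝓞 F)) (h2 : (2 : 𝓞 F) ∉ v.asIdeal)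
    {a b : 𝓞 F} (ha : a ∉ v.asIdeal) (hb : b ∉ v.asIdeal) :
    ∃ r s : v.adicCompletion F, r ^ 2 = algebraMap F (v.adicCompletion F) a * s ^ 2 +
      algebraMap F (v.adicCompletion F) b := by
  have hemb : ∀ x : F, algebraMap F (v.adicCompletion F) x = FinitePlace.embedding v x :=
    fun x => rfl
  simp only [hemb]
  set φ := FinitePlace.embedding (K := F) v
  have hone : ∀ x : 𝓞 F, ‖φ x‖ = 1 ↔ x ∉ v.asIdeal := FinitePlace.norm_eq_one_iff_notMem F v
  have hlt : ∀ x : 𝓞 F, ‖φ x‖ < 1 ↔ x ∈ v.asIdeal := FinitePlace.norm_lt_one_iff_mem F v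
  have h2' : ‖(2 : v.adicCompletion F)‖ = 1 := by
    have := (hone 2).mpr h2
    rwa [show ((2 : 𝓞 F) : F) = 2 from rfl, map_ofNat] at this
  have hmax : v.asIdeal.IsMaximal := v.isMaximal
  let : Field (𝓞 F ⧸ v.asIdeal) := Ideal.Quotient.field _
  have : Finite (𝓞 F ⧸ v.asIdeal) := v.asIdeal.finiteQuotientOfFreeOfNeBot v.ne_bot
  let := Fintype.ofFinite (𝓞 F ⧸ v.asIdeal)
  let π := Ideal.Quotient.mk v.asIdeal
  have hπ : ∀ x, π x = 0 ↔ x ∈ v.asIdeal := fun x => Ideal.Quotient.eq_zero_iff_mem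
  have hchar : ringChar (𝓞 F ⧸ v.asIdeal) ≠ 2 := by
    intro h
    apply h2
    rw [← hπ]
    have := ringChar.Nat.cast_ringChar (R := 𝓞 F ⧸ v.asIdeal)
    rw [h] at this
    rw [map_ofNat]; exact_mod_cast this
  obtain ⟨x', y', hxy⟩ := FiniteField.exists_root_sum_quadratic
    (f := Polynomial.X ^ 2)
    (g := Polynomial.C (-π a) * Polynomial.X ^ 2 + Polynomial.C 0 * Polynomial.X
      + Polynomial.C (-π b))
    (Polynomial.degree_X_pow 2)
    (Polynomial.degree_quadratic (neg_ne_zero.mpr (mt (hπ a).mp ha)))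
    (FiniteField.odd_card_of_char_ne_two hchar)
  obtain ⟨x, rfl⟩ := Ideal.Quotient.mk_surjective x'
  obtain ⟨y, rfl⟩ := Ideal.Quotient.mk_surjective y'
  have hmem : x ^ 2 - (a * y ^ 2 + b) ∈ v.asIdeal := by
    rw [← hπ, ← hxy]
    simp [π]
    ring
  by_cases hx : x ∈ v.asIdeal
  · have hφa : φ a ≠ 0 := by
      intro h; have := (hone a).mpr ha; rw [h, norm_zero] at this; exact zero_ne_one this
    have hmem' : a * y ^ 2 + b ∈ v.asIdeal := by
      have := v.asIdeal.sub_mem (v.asIdeal.pow_mem_of_mem hx 2 two_pos) hmem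
      rwa [sub_sub_cancel] at this
    have hy : y ∉ v.asIdeal := fun hy => hb <| by
      have := v.asIdeal.sub_mem hmem' (v.asIdeal.mul_mem_left a
        (v.asIdeal.pow_mem_of_mem hy 2 two_pos))
      rwa [add_sub_cancel_left] at this
    obtain ⟨s, hs⟩ := exists_sq_eq_of_norm_sq_sub_lt_one (x := φ y) (c := -φ b / φ a) h2'
      ((hone y).mpr hy) (by
        have : φ y ^ 2 - -φ b / φ a = φ ((a * y ^ 2 + b : 𝓞 F) : F) / φ a := by
          push_cast
          rw [map_add, map_mul, map_pow]
          field_simp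
          ring
        rw [this, norm_div, (hone a).mpr ha, div_one]
        exact (hlt _).mpr hmem')
    exact ⟨0, s, by rw [hs]; field_simp; ring⟩
  · obtain ⟨r, hr⟩ := exists_sq_eq_of_norm_sq_sub_lt_one (x := φ x)
      (c := φ a * φ y ^ 2 + φ b) h2' ((hone x).mpr hx) (by
        have : φ x ^ 2 - (φ a * φ y ^ 2 + φ b) = φ ((x ^ 2 - (a * y ^ 2 + b) : 𝓞 F) : F) := by
          push_cast
          rw [map_sub, map_add, map_mul, map_pow, map_pow]
        rw [this]
        exact (hlt _).mpr hmem)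
    exact ⟨r, φ y, hr⟩

end LocalSplitting

section ReducedNorm

variable {K : Type*} [Field K] {A B : K}

/-- The reduced trace of a quaternion. -/
def trd (x : ℍ[K, A, B]) : K := 2 * x.re

/-- The reduced norm of a quaternion. -/
def nrd (x : ℍ[K, A, B]) : K :=
  x.re ^ 2 - A * x.imI ^ 2 - B * x.imJ ^ 2 + A * B * x.imK ^ 2

theorem add_star_eq_trd (x : ℍ[K, A, B]) : x + star x = algebraMap K _ (trd x) := by
  ext <;> simp [trd, QuaternionAlgebra.algebraMap_eq]; ring

theorem mul_star_eq_nrd (x : ℍ[K, A, B]) : x * star x = algebraMap K _ (nrd x) := by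
  ext <;> simp [nrd, QuaternionAlgebra.algebraMap_eq] <;> ring

theorem mul_self_eq (x : ℍ[K, A, B]) :
    x * x = algebraMap K _ (trd x) * x - algebraMap K _ (nrd x) := by
  rw [← add_star_eq_trd, ← mul_star_eq_nrd, add_mul, QuaternionAlgebra.star_mul_eq_coe,
    QuaternionAlgebra.mul_star_eq_coe]
  simp

theorem mul_self_of_trd_eq_zero {x : ℍ[K, A, B]} (hx : trd x = 0) :
    x * x = algebraMap K _ (-nrd x) := by
  rw [mul_self_eq, hx, map_zero, zero_mul, zero_sub, map_neg]

theorem star_of_trd_eq_zero {x : ℍ[K, A, B]} (hx : trd x = 0) : star x = -x := by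
  rw [eq_neg_iff_add_eq_zero, add_comm, add_star_eq_trd, hx, map_zero]

theorem nrd_mul (x y : ℍ[K, A, B]) : nrd (x * y) = nrd x * nrd y := by
  simp [nrd]
  ring

theorem trd_mul_comm (x y : ℍ[K, A, B]) : trd (x * y) = trd (y * x) := by
  simp [trd, -mul_eq_mul_left_iff]
  ring

theorem trd_sub (x y : ℍ[K, A, B]) : trd (x - y) = trd x - trd y := by
  simp [trd]; ring

theorem trd_neg (x : ℍ[K, A, B]) : trd (-x) = -trd x := by
  simp [trd]

theorem trd_algebraMap_mul (c : K) (x : ℍ[K, A, B]) : trd (algebraMap K _ c * x) = c * trd x := by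
  simp [trd, QuaternionAlgebra.algebraMap_eq]; ring

theorem trd_algebraMap (c : K) : trd (algebraMap K ℍ[K, A, B] c) = 2 * c := by
  simp [trd, QuaternionAlgebra.algebraMap_eq]

theorem nrd_algebraMap (c : K) : nrd (algebraMap K ℍ[K, A, B] c) = c ^ 2 := by
  simp [nrd, QuaternionAlgebra.algebraMap_eq]

theorem trd_one : trd (1 : ℍ[K, A, B]) = 2 := by simp [trd]

theorem nrd_one : nrd (1 : ℍ[K, A, B]) = 1 := by simp [nrd]

theorem trd_mul_self (x : ℍ[K, A, B]) : trd (x * x) = trd x ^ 2 - 2 * nrd x := by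
  rw [mul_self_eq, trd_sub, trd_algebraMap_mul, trd_algebraMap, sq]

theorem trd_sq_le (σ : K →+* ℝ) (hA : σ A < 0) (hB : σ B < 0) (x : ℍ[K, A, B]) :
    σ (trd x) ^ 2 ≤ 4 * σ (nrd x) := by
  simp only [trd, nrd, map_add, map_sub, map_mul, map_pow, map_ofNat]
  nlinarith [mul_nonneg (neg_nonneg.mpr hA.le) (sq_nonneg (σ x.imI)),
    mul_nonneg (neg_nonneg.mpr hB.le) (sq_nonneg (σ x.imJ)),
    mul_nonneg (mul_nonneg_of_nonpos_of_nonpos hA.le hB.le) (sq_nonneg (σ x.imK))]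

theorem eq_algebraMap_of_trd_sq_eq (σ : K →+* ℝ) (hA : σ A < 0) (hB : σ B < 0) {x : ℍ[K, A, B]}
    (hx : trd x ^ 2 = 4 * nrd x) : x = algebraMap K _ (trd x / 2) := by
  have h : σ (trd x) ^ 2 = 4 * σ (nrd x) := by
    rw [← map_pow, hx, map_mul, map_ofNat]
  simp only [trd, nrd, map_add, map_sub, map_mul, map_pow, map_ofNat] at h
  have hi := mul_nonneg (neg_nonneg.mpr hA.le) (sq_nonneg (σ x.imI))
  have hj := mul_nonneg (neg_nonneg.mpr hB.le) (sq_nonneg (σ x.imJ))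
  have hAB := mul_pos_of_neg_of_neg hA hB
  have hk := mul_nonneg hAB.le (sq_nonneg (σ x.imK))
  have hi0 : σ A * σ x.imI ^ 2 = 0 := by linarith
  have hj0 : σ B * σ x.imJ ^ 2 = 0 := by linarith
  have hk0 : σ A * σ B * σ x.imK ^ 2 = 0 := by linarith
  simp only [mul_eq_zero, hA.ne, hB.ne, or_self, false_or, pow_eq_zero_iff two_ne_zero,
    map_eq_zero] at hi0 hj0 hk0
  have h2 : (2 : K) ≠ 0 := fun h2 => two_ne_zero (α := ℝ) (by rw [← map_ofNat σ, h2, map_zero])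
  ext <;> simp [trd, QuaternionAlgebra.algebraMap_eq, *]

theorem eq_zero_of_nrd_eq_zero (σ : K →+* ℝ) (hA : σ A < 0) (hB : σ B < 0) {x : ℍ[K, A, B]}
    (hx : nrd x = 0) : x = 0 := by
  have h := trd_sq_le σ hA hB x
  rw [hx, map_zero, mul_zero] at h
  have ht : trd x = 0 := by
    have : σ (trd x) = 0 := by nlinarith
    exact (map_eq_zero σ).mp this
  rw [eq_algebraMap_of_trd_sq_eq σ hA hB (x := x) (by rw [hx, ht]; ring), ht]
  simp

theorem eq_zero_or_eq_zero_of_mul_eq_zero (σ : K →+* ℝ) (hA : σ A < 0) (hB : σ B < 0)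
    {x y : ℍ[K, A, B]} (h : x * y = 0) : x = 0 ∨ y = 0 := by
  have : nrd x * nrd y = 0 := by rw [← nrd_mul, h]; simp [nrd]
  exact (mul_eq_zero.mp this).imp (eq_zero_of_nrd_eq_zero σ hA hB) (eq_zero_of_nrd_eq_zero σ hA hB)

/-- The algebra `H` contains anticommuting elements with squares `a` and `b`. -/
def HasAnticommutingPair (a b : K) (H : Type*) [Ring H] [Algebra K H] : Prop :=
  ∃ x y : H, x * x = algebraMap K H a ∧ y * y = algebraMap K H b ∧ x * y = -(y * x)

theorem HasAnticommutingPair.symm {a b : K} {H : Type*} [Ring H] [Algebra K H]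
    (h : HasAnticommutingPair a b H) : HasAnticommutingPair b a H := by
  obtain ⟨x, y, hx, hy, hxy⟩ := h
  exact ⟨y, x, hy, hx, by rw [hxy, neg_neg]⟩

theorem HasAnticommutingPair.of_mul_sq {a b v w : K} (hv : v ≠ 0) (hw : w ≠ 0)
    {H : Type*} [Ring H] [Algebra K H] (h : HasAnticommutingPair (a * v ^ 2) (b * w ^ 2) H) :
    HasAnticommutingPair a b H := by
  obtain ⟨x, y, hx, hy, hxy⟩ := h
  refine ⟨v⁻¹ • x, w⁻¹ • y, ?_, ?_, ?_⟩
  · rw [smul_mul_smul_comm, hx, Algebra.smul_def, ← map_mul]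
    congr 1; field_simp
  · rw [smul_mul_smul_comm, hy, Algebra.smul_def, ← map_mul]
    congr 1; field_simp
  · rw [smul_mul_smul_comm, hxy, smul_mul_smul_comm, mul_comm, smul_neg]

theorem HasAnticommutingPair.neg_one_of_self {e : K} (he : e ≠ 0) {H : Type*} [Ring H] [Algebra K H]
    (h : HasAnticommutingPair (-e) (-e) H) : HasAnticommutingPair (-1) (-e) H := by
  obtain ⟨x, y, hx, hy, hxy⟩ := h
  refine HasAnticommutingPair.of_mul_sq he one_ne_zero ⟨x * y, y, ?_, by rw [hy]; simp, ?_⟩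
  · calc x * y * (x * y) = x * (y * x) * y := by simp only [mul_assoc]
      _ = -((x * x) * (y * y)) := by
        rw [← neg_eq_iff_eq_neg.mpr hxy]; simp only [mul_neg, neg_mul, mul_assoc]
      _ = _ := by rw [hx, hy, ← map_mul, ← map_neg]; congr 1; ring
  · rw [← mul_assoc y x y, ← neg_mul, ← hxy]

theorem nonempty_algEquiv_of_hasAnticommutingPair (σ : K →+* ℝ) {a b : K} (ha : σ a < 0)
    (hb : σ b < 0) (h : HasAnticommutingPair a b ℍ[K, A, B]) :
    Nonempty (ℍ[K, A, B] ≃ₐ[K] ℍ[K, a, b]) := by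
  obtain ⟨x, y, hx, hy, hxy⟩ := h
  let q : QuaternionAlgebra.Basis ℍ[K, A, B] a 0 b :=
    { i := x, j := y, k := x * y
      i_mul_i := by rw [hx, Algebra.algebraMap_eq_smul_one, zero_smul, add_zero]
      j_mul_j := by rw [hy, Algebra.algebraMap_eq_smul_one]
      i_mul_j := rfl
      j_mul_i := by rw [hxy, zero_smul, zero_sub, neg_neg] }
  have hinj : Function.Injective q.liftHom := by
    refine (injective_iff_map_eq_zero _).mpr fun z hz => ?_
    apply eq_zero_of_nrd_eq_zero σ ha hb
    have : q.liftHom (z * star z) = 0 := by rw [map_mul, hz, zero_mul]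
    rw [mul_star_eq_nrd, AlgHom.commutes] at this
    exact (map_eq_zero_iff _ (algebraMap K ℍ[K, A, B]).injective).mp this
  have hsurj : Function.Surjective q.liftHom := by
    refine (LinearMap.injective_iff_surjective_of_finrank_eq_finrank
      (f := q.liftHom.toLinearMap) ?_).mp hinj
    rw [QuaternionAlgebra.finrank_eq_four, QuaternionAlgebra.finrank_eq_four]
  exact ⟨(AlgEquiv.ofBijective q.liftHom ⟨hinj, hsurj⟩).symm⟩

theorem hasAnticommutingPair_of_algEquiv {a b : K} (e : ℍ[K, A, B] ≃ₐ[K] ℍ[K, a, b]) :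
    HasAnticommutingPair a b ℍ[K, A, B] := by
  let q := QuaternionAlgebra.Basis.self K (c₁ := a) (c₂ := 0) (c₃ := b)
  refine ⟨e.symm q.i, e.symm q.j, ?_, ?_, ?_⟩
  · rw [← map_mul, q.i_mul_i, zero_smul, add_zero, ← Algebra.algebraMap_eq_smul_one, e.symm.commutes]
  · rw [← map_mul, q.j_mul_j, ← Algebra.algebraMap_eq_smul_one, e.symm.commutes]
  · rw [← map_mul, ← map_mul, q.i_mul_j, q.j_mul_i, zero_smul, zero_sub, map_neg, neg_neg]

theorem not_hasAnticommutingPair_of_isUnit {L : Type*} [Field L] [Algebra K L] [CharZero L]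
    {a b : K} (ha : a ≠ 0) (hb : b ≠ 0)
    (hsol : ∃ r s : L, r ^ 2 = algebraMap K L a * s ^ 2 + algebraMap K L b)
    (hdiv : ∀ x : ℍ[L, algebraMap K L A, algebraMap K L B], x ≠ 0 → IsUnit x) :
    ¬HasAnticommutingPair a b ℍ[K, A, B] := by
  rintro ⟨x, y, hx, hy, hxy⟩
  obtain ⟨r, s, hrs⟩ := hsol
  set A' := algebraMap K L A
  set B' := algebraMap K L B
  let f : ℍ[K, A, B] →+* ℍ[L, A', B'] :=
    { toFun := fun z => ⟨algebraMap K L z.re, algebraMap K L z.imI, algebraMap K L z.imJ,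
        algebraMap K L z.imK⟩
      map_zero' := by ext <;> simp
      map_one' := by ext <;> simp
      map_add' := fun z w => by ext <;> simp
      map_mul' := fun z w => by ext <;> simp [A', B'] }
  have hf : ∀ c : K, f (algebraMap K _ c) = algebraMap L _ (algebraMap K L c) := fun c => by
    ext <;> simp [f, QuaternionAlgebra.algebraMap_eq]
  have hx' := congrArg f hx
  have hy' := congrArg f hy
  have hxy' := congrArg f hxy
  rw [map_mul, hf] at hx' hy'
  rw [map_neg, map_mul, map_mul] at hxy'
  set X := f x
  set Y := f y
  have hunit : ∀ {c : K} {Z : ℍ[L, A', B']}, c ≠ 0 → Z * Z = algebraMap L _ (algebraMap K L c) →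
      IsUnit Z := fun {c Z} hc hZ => hdiv Z fun h0 => hc <| by
    rw [h0, zero_mul] at hZ
    have h1 := (map_eq_zero_iff _ (algebraMap L ℍ[L, A', B']).injective).mp hZ.symm
    exact (map_eq_zero _).mp h1
  have hXu := hunit ha hx'
  have hYu := hunit hb hy'
  have hrel : ∀ z : ℍ[L, A', B'], Commute (algebraMap L _ r) z := fun z => Algebra.commutes r z
  set R := algebraMap L ℍ[L, A', B'] r
  set W := s • X + Y
  have hXW : (s • X + Y) * (s • X + Y) = R * R := by
    have : R * R = algebraMap L _ (algebraMap K L a * s ^ 2 + algebraMap K L b) := by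
      rw [← hrs, sq, map_mul]
    rw [this, map_add, ← hy', mul_comm, map_mul, ← hx', ← Algebra.smul_def]
    rw [add_mul, mul_add, mul_add, smul_mul_assoc, mul_smul_comm, smul_mul_assoc, mul_smul_comm,
      hxy', smul_smul, sq, smul_neg]
    abel
  have hprod : (R + W) * (R - W) = 0 := by
    rw [add_mul, mul_sub, mul_sub, hXW, (hrel W).eq]
    abel
  have hcontra : ∀ (p q : L) (hq : q ≠ 0), algebraMap L _ p + q • W ≠ 0 := by
    intro p q hq h
    have hcomm : Commute (q • W) X := by
      rw [eq_neg_of_add_eq_zero_right h]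
      exact Commute.neg_left (Algebra.commutes p X)
    have hWX : W * X = X * W := by
      have := hcomm.eq
      rw [smul_mul_assoc, mul_smul_comm] at this
      exact smul_right_injective _ hq this
    rw [add_mul, mul_add, smul_mul_assoc, mul_smul_comm] at hWX
    have hYX := add_left_cancel hWX
    rw [hxy', eq_neg_iff_add_eq_zero, ← two_smul L] at hYX
    exact (hYu.mul hXu).ne_zero ((smul_eq_zero.mp hYX).resolve_left two_ne_zero)
  by_cases h0 : R + W = 0
  · exact hcontra r 1 one_ne_zero (by rw [one_smul]; exact h0)
  · have := (hdiv _ h0).mul_right_eq_zero.mp hprod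
    exact hcontra r (-1) (by simp) (by rw [neg_one_smul, ← sub_eq_add_neg]; exact this)

end ReducedNorm

section UnitGroups

variable {K : Type*} [Field K] {A B : K} {Γ : Type*} [Group Γ] (ι : Γ →* ℍ[K, A, B])

theorem nrd_map_ne_zero (u : Γ) : nrd (ι u) ≠ 0 := by
  intro h
  have : nrd (ι u) * nrd (ι u⁻¹) = 1 := by rw [← nrd_mul, ← map_mul, mul_inv_cancel, map_one, nrd_one]
  rw [h, zero_mul] at this
  exact zero_ne_one this

theorem nrd_mul_trd_mul_inv (u v : Γ) :
    nrd (ι v) * trd (ι (u * v⁻¹)) = trd (ι u) * trd (ι v) - trd (ι (u * v)) := by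
  have h : algebraMap K _ (nrd (ι v)) * ι (u * v⁻¹) = algebraMap K _ (trd (ι v)) * ι u - ι (u * v) := by
    have hv : ι v * ι v⁻¹ = 1 := by rw [← map_mul, mul_inv_cancel, map_one]
    have h0 : algebraMap K _ (nrd (ι v)) = algebraMap K _ (trd (ι v)) * ι v - ι v * ι v := by
      rw [mul_self_eq (ι v)]; abel
    rw [map_mul, ← mul_assoc, Algebra.commutes, mul_assoc, h0, sub_mul, mul_assoc, mul_assoc, hv,
      mul_one, mul_one, mul_sub, ← Algebra.commutes, ← map_mul]
  rw [← trd_algebraMap_mul, h, trd_sub, trd_algebraMap_mul, mul_comm]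

variable (σ : K →+* ℝ) (hA : σ A < 0) (hB : σ B < 0)
  (hΓ : ∀ u : Γ, ∃ k : ℕ, k ≤ 4 ∧ trd (ι u) ^ 2 = k * nrd (ι u))
include hA hB hΓ

theorem mul_comm_of_trd_eq_zero
    (hpair : ∀ u v : Γ, ¬HasAnticommutingPair (-nrd (ι u)) (-nrd (ι v)) ℍ[K, A, B])
    (hpair3 : ∀ u : Γ, ¬HasAnticommutingPair (-nrd (ι u)) (-3) ℍ[K, A, B])
    {x y : Γ} (hx : trd (ι x) = 0) (hy : trd (ι y) = 0) : ι x * ι y = ι y * ι x := by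
  have : CharZero K := σ.charZero
  obtain ⟨k, hk4, hk⟩ := hΓ (x * y)
  have hp := nrd_map_ne_zero ι (x * y)
  set p := ι (x * y) with hpdef
  have hpxy : p = ι x * ι y := map_mul ι x y
  have hstar : star p = ι y * ι x := by
    rw [hpxy, star_mul, star_of_trd_eq_zero hx, star_of_trd_eq_zero hy, neg_mul_neg]
  have hxx := mul_self_of_trd_eq_zero hx
  set j := p - star p with hj
  have htj : trd j = 0 := by
    rw [hj, trd_sub, hstar, hpxy, trd_mul_comm, sub_self]
  have hxj : ι x * j = -(j * ι x) := by
    rw [hj, hstar, hpxy, mul_sub, sub_mul, ← mul_assoc, hxx, mul_assoc (ι y), hxx,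
      Algebra.commutes, mul_assoc, neg_sub]
  have hjj : j * j = algebraMap K _ (trd p ^ 2 - 4 * nrd p) := by
    have : j = algebraMap K _ (-trd p) + algebraMap K _ 2 * p := by
      rw [hj, map_neg, ← add_star_eq_trd, map_ofNat, two_mul]; abel
    have hnj : nrd j = 4 * nrd p - trd p ^ 2 := by
      rw [this]
      simp [nrd, trd, QuaternionAlgebra.algebraMap_eq]
      ring
    rw [mul_self_of_trd_eq_zero htj, hnj, neg_sub]
  rw [hk] at hjj
  have base : HasAnticommutingPair (-nrd (ι x)) (k * nrd p - 4 * nrd p) ℍ[K, A, B] :=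
    ⟨ι x, j, hxx, hjj, hxj⟩
  have key : ∀ {b w : K}, w ≠ 0 → (k : K) * nrd p - 4 * nrd p = b * w ^ 2 →
      HasAnticommutingPair (-nrd (ι x)) b ℍ[K, A, B] := fun hw hb =>
    HasAnticommutingPair.of_mul_sq one_ne_zero hw (by rwa [one_pow, mul_one, ← hb])
  have ht : k ≠ 0 → trd p ≠ 0 := fun hk0 h0 => by
    rw [h0] at hk
    simp [hk0, hp] at hk
  interval_cases k
  · exact absurd (key (w := 2) two_ne_zero (by push_cast; ring)) (hpair x (x * y))
  · exact absurd (key (b := -3) (ht one_ne_zero) (by rw [hk]; push_cast; ring)) (hpair3 x)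
  · refine absurd (key (b := -nrd (ι 1)) (ht two_ne_zero) ?_) (hpair x 1)
    rw [hk, map_one, nrd_one]; push_cast; ring
  · exact absurd (key (w := 1) one_ne_zero (by push_cast; ring)) (hpair x (x * y))
  · have hj0 : j = 0 := by
      rw [show ((4 : ℕ) : K) * nrd p - 4 * nrd p = 0 by push_cast; ring, map_zero] at hjj
      exact (or_self_iff).mp (eq_zero_or_eq_zero_of_mul_eq_zero σ hA hB hjj)
    rw [← hpxy, ← hstar]
    exact sub_eq_zero.mp hj0

theorem mul_comm_of_not_hasAnticommutingPair
    (hpair : ∀ u v : Γ, ¬HasAnticommutingPair (-nrd (ι u)) (-nrd (ι v)) ℍ[K, A, B])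
    (hpair3 : ∀ u : Γ, ¬HasAnticommutingPair (-nrd (ι u)) (-3) ℍ[K, A, B])
    (u v : Γ) : ι u * ι v = ι v * ι u := by
  have : CharZero K := σ.charZero
  have hcomm0 : ∀ {x y : Γ}, trd (ι x) = 0 → trd (ι y) = 0 → ι x * ι y = ι y * ι x :=
    mul_comm_of_trd_eq_zero ι σ hA hB hΓ hpair hpair3
  have hdom : ∀ {x y : ℍ[K, A, B]}, x * y = 0 → x = 0 ∨ y = 0 :=
    eq_zero_or_eq_zero_of_mul_eq_zero σ hA hB
  have hinv : ∀ w : Γ, ι w * ι w⁻¹ = 1 := fun w => by rw [← map_mul, mul_inv_cancel, map_one]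
  have hinv' : ∀ w : Γ, ι w⁻¹ * ι w = 1 := fun w => by rw [← map_mul, inv_mul_cancel, map_one]
  by_cases hex : ∃ x : Γ, trd (ι x) = 0
  · obtain ⟨x, hx⟩ := hex
    have hxx := mul_self_of_trd_eq_zero hx
    have hux : ∀ w : Γ, ι w * ι x = ι x * ι w := by
      intro w
      have hy : trd (ι (w * x * w⁻¹)) = 0 := by
        rw [map_mul, trd_mul_comm, ← map_mul, inv_mul_cancel_left, hx]
      have hyw : ι (w * x * w⁻¹) * ι w = ι w * ι x := by
        rw [← map_mul, inv_mul_cancel_right, map_mul]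
      have hyy : ι (w * x * w⁻¹) * ι (w * x * w⁻¹) = ι x * ι x := by
        rw [hxx, mul_self_of_trd_eq_zero hy]
        congr 2
        rw [map_mul, map_mul, nrd_mul, nrd_mul, mul_right_comm, ← nrd_mul, hinv, nrd_one, one_mul]
      have hcy := hcomm0 hy hx
      rcases hdom (x := ι (w * x * w⁻¹) - ι x) (y := ι (w * x * w⁻¹) + ι x) (by
        rw [sub_mul, mul_add, mul_add, hyy, hcy]; abel) with h | h
      · rw [← hyw, sub_eq_zero.mp h]
      · have hanti : ι w * ι x = -(ι x * ι w) := by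
          rw [← hyw, eq_neg_of_add_eq_zero_left h, neg_mul]
        have htw : trd (ι w) = 0 := by
          have h1 : trd (ι (x * w * x⁻¹)) = trd (ι w) := by
            rw [map_mul, trd_mul_comm, ← map_mul, inv_mul_cancel_left]
          have h2 : ι (x * w * x⁻¹) = -ι w := by
            rw [map_mul, map_mul, ← neg_eq_iff_eq_neg.mpr hanti, neg_mul, mul_assoc, hinv, mul_one]
          rw [h2, trd_neg] at h1
          exact self_eq_neg.mp h1.symm
        exact hcomm0 htw hx
    have hrep : ∀ w : Γ, ∃ a b : K, ι w = algebraMap K _ a + algebraMap K _ b * ι x := by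
      intro w
      set z := ι w - algebraMap K _ (trd (ι w) / 2) with hz
      have hz0 : trd z = 0 := by rw [hz, trd_sub, trd_algebraMap]; ring
      have hzx : z * ι x = ι x * z := by
        rw [hz, sub_mul, mul_sub, hux, Algebra.commutes]
      have hs : z * ι x + z * ι x = algebraMap K _ (trd (z * ι x)) := by
        rw [← add_star_eq_trd, star_mul, star_of_trd_eq_zero hx, star_of_trd_eq_zero hz0,
          neg_mul_neg, hzx]
      have hs' : z * ι x = algebraMap K _ (trd (z * ι x) / 2) := by
        have h2 : algebraMap K ℍ[K, A, B] 2⁻¹ * 2 = 1 := by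
          rw [← map_ofNat (algebraMap K ℍ[K, A, B]) 2, ← map_mul, inv_mul_cancel₀ two_ne_zero,
            map_one]
        rw [div_eq_inv_mul, map_mul, ← hs, ← two_mul, ← mul_assoc, h2, one_mul]
      have hn := nrd_map_ne_zero ι x
      refine ⟨trd (ι w) / 2, trd (z * ι x) / 2 * (-nrd (ι x))⁻¹, ?_⟩
      rw [mul_comm, map_mul, mul_assoc, ← hs', mul_assoc z, hxx, ← Algebra.commutes _ z, ← mul_assoc,
        ← map_mul, inv_mul_cancel₀ (neg_ne_zero.mpr hn), map_one, one_mul, hz]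
      abel
    obtain ⟨a, b, hu⟩ := hrep u
    rw [hu, add_mul, mul_add, mul_assoc, ← hux v, ← mul_assoc, ← mul_assoc, Algebra.commutes a,
      Algebra.commutes b]
  · push Not at hex
    have hscal : ∀ w : Γ, trd (ι w) ^ 2 = 4 * nrd (ι w) → ∃ c : K, ι w = algebraMap K _ c :=
      fun w hw => ⟨_, eq_algebraMap_of_trd_sq_eq σ hA hB hw⟩
    have hcase : ∀ w : Γ, trd (ι w) ^ 2 = nrd (ι w) ∨ trd (ι w) ^ 2 = 4 * nrd (ι w) := by
      intro w
      obtain ⟨k, hk4, hk⟩ := hΓ w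
      interval_cases k
      · exact absurd (by simpa using hk) (hex w)
      · left; simpa using hk
      · refine absurd ?_ (hex (w * w))
        rw [map_mul, trd_mul_self, hk]; push_cast; ring
      · refine absurd ?_ (hex (w * w * w))
        rw [map_mul, map_mul, mul_self_eq, sub_mul, mul_assoc, mul_self_eq, trd_sub,
          trd_algebraMap_mul, trd_algebraMap_mul, trd_sub, trd_algebraMap_mul, trd_algebraMap]
        linear_combination trd (ι w) * hk
      · right; simpa using hk
    rcases hcase u with hu | hu
    swap
    · obtain ⟨c, hc⟩ := hscal u hu
      rw [hc, Algebra.commutes]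
    rcases hcase v with hv | hv
    swap
    · obtain ⟨c, hc⟩ := hscal v hv
      rw [hc, Algebra.commutes]
    rcases hcase (u * v) with huv | huv
    swap
    · obtain ⟨c, hc⟩ := hscal _ huv
      have : ι u = algebraMap K _ c * ι v⁻¹ := by
        rw [← hc, ← map_mul, mul_inv_cancel_right]
      rw [this, mul_assoc, hinv', ← mul_assoc, ← Algebra.commutes c, mul_assoc, hinv]
    rcases hcase (u * v⁻¹) with huv' | huv'
    swap
    · obtain ⟨c, hc⟩ := hscal _ huv'
      have : ι u = algebraMap K _ c * ι v := by
        rw [← hc, ← map_mul, inv_mul_cancel_right]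
      rw [this, ← mul_assoc, ← Algebra.commutes c]
    exfalso
    have hN : nrd (ι (u * v)) = nrd (ι u) * nrd (ι v) := by rw [map_mul, nrd_mul]
    have hN' : nrd (ι (u * v⁻¹)) * nrd (ι v) = nrd (ι u) := by
      rw [← nrd_mul, ← map_mul, inv_mul_cancel_right]
    have hT := nrd_mul_trd_mul_inv ι u v
    have hnu := nrd_map_ne_zero ι u
    have hnv := nrd_map_ne_zero ι v
    set τ := trd (ι (u * v))
    set m := trd (ι u) * trd (ι v) with hm
    have hm2 : m ^ 2 = nrd (ι u) * nrd (ι v) := by rw [hm, mul_pow, hu, hv]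
    have h1 : τ ^ 2 = m ^ 2 := by rw [huv, hN, hm2]
    have h2 : (m - τ) ^ 2 = m ^ 2 := by
      rw [← hT, mul_pow, huv', hm2, sq, ← hN']; ring
    have hm0 : m ^ 2 ≠ 0 := by rw [hm2]; exact mul_ne_zero hnu hnv
    rcases sq_eq_sq_iff_eq_or_eq_neg.mp h1 with h | h
    · rw [h] at h2
      apply hm0
      rw [← h2]; ring
    · rw [h] at h2
      apply hm0
      have : (3 : K) * m ^ 2 = 0 := by linear_combination h2
      exact (mul_eq_zero.mp this).resolve_left three_ne_zero

open scoped IsMulCommutative in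
theorem exists_generator_of_mul_comm (hcomm : ∀ u v : Γ, ι u * ι v = ι v * ι u) :
    ∃ g : Γ, ∀ u : Γ, ∃ n : ℤ, ∃ c : K, ι u = algebraMap K _ c * ι (g ^ n) := by
  have : CharZero K := σ.charZero
  let S := Algebra.adjoin K (Set.range ι)
  have : IsMulCommutative S := Algebra.isMulCommutative_adjoin K (by
    rintro _ ⟨u, rfl⟩ _ ⟨v, rfl⟩
    exact hcomm u v)
  have : NoZeroDivisors S := ⟨fun {a b} hab => by
    have := congrArg (Subtype.val) hab
    rcases eq_zero_or_eq_zero_of_mul_eq_zero σ hA hB this with h | h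
    · exact Or.inl (Subtype.ext h)
    · exact Or.inr (Subtype.ext h)⟩
  have : Nontrivial S := ⟨⟨0, 1, fun h => zero_ne_one (congrArg Subtype.val h)⟩⟩
  have : IsDomain S := NoZeroDivisors.to_isDomain S
  let ζ : Γ → ℍ[K, A, B] := fun u => (nrd (ι u))⁻¹ • (ι u * ι u)
  let f : Γ →* S :=
    { toFun := fun u => ⟨ζ u, S.smul_mem (S.mul_mem (Algebra.subset_adjoin ⟨u, rfl⟩)
        (Algebra.subset_adjoin ⟨u, rfl⟩)) _⟩
      map_one' := Subtype.ext (by simp [ζ, nrd_one])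
      map_mul' := fun u v => Subtype.ext (by
        change ζ (u * v) = ζ u * ζ v
        simp only [ζ]
        rw [map_mul, nrd_mul, mul_inv, smul_mul_smul_comm]
        congr 1
        rw [mul_assoc, ← mul_assoc (ι v), ← hcomm u v, mul_assoc, mul_assoc]) }
  have hnζ : ∀ u, nrd (ζ u) = 1 := fun u => by
    have := nrd_map_ne_zero ι u
    simp only [ζ]
    rw [Algebra.smul_def, nrd_mul, nrd_algebraMap, nrd_mul]
    field_simp
  have htζ : ∀ u, ∀ k : K, trd (ι u) ^ 2 = k * nrd (ι u) → trd (ζ u) = k - 2 := fun u k hk => by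
    have := nrd_map_ne_zero ι u
    simp only [ζ]
    rw [Algebra.smul_def, trd_algebraMap_mul, trd_mul_self, hk]
    field_simp
  have hpow : ∀ u, ζ u ^ 12 = 1 := by
    intro u
    obtain ⟨k, hk4, hk⟩ := hΓ u
    have ht := htζ u k hk
    have hn := hnζ u
    have hsq := mul_self_eq (ζ u)
    rw [ht, hn, map_one] at hsq
    interval_cases k
    · have := eq_algebraMap_of_trd_sq_eq σ hA hB (x := ζ u) (by rw [ht, hn]; norm_num)
      rw [this, ht, ← map_pow]
      norm_num
    · have h3 : ζ u ^ 3 = 1 := by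
        rw [show ((1 : ℕ) : K) - 2 = -1 by norm_num, map_neg, map_one, neg_one_mul] at hsq
        rw [pow_succ, sq, hsq, sub_mul, neg_mul, hsq]
        simp
      rw [show 12 = 3 * 4 by rfl, pow_mul, h3, one_pow]
    · have h2 : ζ u ^ 2 = -1 := by
        rw [sq, hsq]; simp
      rw [show 12 = 2 * 6 by rfl, pow_mul, h2]
      norm_num
    · have h3 : ζ u ^ 3 = -1 := by
        rw [show ((3 : ℕ) : K) - 2 = 1 by norm_num, map_one, one_mul] at hsq
        rw [pow_succ, sq, hsq, sub_mul, hsq]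
        simp
      rw [show 12 = 3 * 4 by rfl, pow_mul, h3]
      norm_num
    · have := eq_algebraMap_of_trd_sq_eq σ hA hB (x := ζ u) (by rw [ht, hn]; norm_num)
      rw [this, ht, ← map_pow]
      norm_num
  have hle : f.toHomUnits.range ≤ rootsOfUnity 12 S := by
    rintro _ ⟨u, rfl⟩
    rw [mem_rootsOfUnity']
    exact Subtype.ext (hpow u)
  have hcyc : IsCyclic f.toHomUnits.range :=
    isCyclic_of_injective (Subgroup.inclusion hle) (Subgroup.inclusion_injective hle)
  obtain ⟨⟨_, g, rfl⟩, hg⟩ := hcyc.exists_generator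
  refine ⟨g, fun u => ?_⟩
  obtain ⟨n, hn⟩ := hg ⟨f.toHomUnits u, u, rfl⟩
  refine ⟨n, ?_⟩
  have hn' : f.toHomUnits g ^ n = f.toHomUnits u := congrArg Subtype.val hn
  have hone : ζ (u * (g ^ n)⁻¹) = 1 := by
    have : f.toHomUnits (u * (g ^ n)⁻¹) = 1 := by
      rw [map_mul, map_inv, map_zpow, hn', mul_inv_cancel]
    exact congrArg (fun w : Sˣ => ((w : S) : ℍ[K, A, B])) this
  set w := u * (g ^ n)⁻¹ with hw
  have hk : trd (ι w) ^ 2 = 4 * nrd (ι w) := by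
    have h := htζ w (trd (ι w) ^ 2 / nrd (ι w)) (div_mul_cancel₀ _ (nrd_map_ne_zero ι w)).symm
    rw [hone, trd_one, eq_sub_iff_add_eq, eq_div_iff (nrd_map_ne_zero ι w)] at h
    rw [← h]; norm_num
  refine ⟨trd (ι w) / 2, ?_⟩
  rw [← eq_algebraMap_of_trd_sq_eq σ hA hB hk, ← map_mul, hw, inv_mul_cancel_right]

end UnitGroups

section Integrality

variable {K : Type*} [Field K] {A B : K}

theorem isIntegral_star {x : ℍ[K, A, B]} (hx : IsIntegral ℤ x) : IsIntegral ℤ (star x) := by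
  obtain ⟨p, hp, h⟩ := hx
  refine ⟨p, hp, ?_⟩
  have := congrArg star h
  rw [star_zero, Polynomial.eval₂_eq_sum_range, star_sum] at this
  rw [Polynomial.eval₂_eq_sum_range, ← this]
  refine Finset.sum_congr rfl fun i _ => ?_
  rw [star_mul, star_pow, eq_intCast, star_intCast, Int.cast_comm]

theorem isIntegral_trd_and_nrd {x : ℍ[K, A, B]} (hx : IsIntegral ℤ x) :
    IsIntegral ℤ (trd x) ∧ IsIntegral ℤ (nrd x) := by
  have hmem : star x ∈ Algebra.adjoin K {x} := by
    rw [eq_sub_of_add_eq' (add_star_eq_trd x)]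
    exact sub_mem (Subalgebra.algebraMap_mem _ _) (Algebra.self_mem_adjoin_singleton K x)
  have hinj : Function.Injective ((Algebra.adjoin K {x}).val.restrictScalars ℤ) :=
    Subtype.val_injective
  have h1 : IsIntegral ℤ (⟨x, Algebra.self_mem_adjoin_singleton K x⟩ : Algebra.adjoin K {x}) :=
    (isIntegral_algHom_iff _ hinj).mp hx
  have h2 : IsIntegral ℤ (⟨star x, hmem⟩ : Algebra.adjoin K {x}) :=
    (isIntegral_algHom_iff _ hinj).mp (isIntegral_star hx)
  have hK : Function.Injective (algebraMap K ℍ[K, A, B]) := (algebraMap K _).injective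
  constructor
  · rw [← isIntegral_algebraMap_iff hK, ← add_star_eq_trd]
    exact (isIntegral_algHom_iff _ hinj).mpr (h1.add h2)
  · rw [← isIntegral_algebraMap_iff hK, ← mul_star_eq_nrd]
    exact (isIntegral_algHom_iff _ hinj).mpr (h1.mul h2)

end Integrality

section OrderUnits

variable {F}
omit [NumberField F]

theorem IsOrder.isIntegral {H : Type} [Ring H] [Algebra F H] {O : Subring H} (hO : IsOrder F O)
    {x : H} (hx : x ∈ O) : IsIntegral ℤ x := by
  refine IsIntegral.of_mem_of_fg (subalgebraOfSubring O) ?_ x hx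
  rw [Submodule.fg_iff_addSubgroup_fg]
  exact hO.2.1

theorem exists_unit_eq {x y : F} (hx : IsIntegral ℤ x) (hy : IsIntegral ℤ y) (hxy : x * y = 1) :
    ∃ r : (𝓞 F)ˣ, algebraMap (𝓞 F) F ↑r = x :=
  ⟨⟨⟨x, hx⟩, ⟨y, hy⟩, Subtype.ext hxy, Subtype.ext ((mul_comm y x).trans hxy)⟩, rfl⟩

variable {A B : F}

/-- The inclusion of the unit group of a subring, as a homomorphism into the ambient ring. -/
def unitVal (O : Subring ℍ[F, A, B]) : (↥O)ˣ →* ℍ[F, A, B] :=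
  (O.subtype : ↥O →* ℍ[F, A, B]).comp (Units.coeHom ↥O)

variable {O : Subring ℍ[F, A, B]}

theorem nrd_unitVal_pos {τ : F →+* ℝ} (hA : τ A < 0) (hB : τ B < 0) (u : (↥O)ˣ) :
    0 < τ (nrd (unitVal O u)) := by
  have h := trd_sq_le τ hA hB (unitVal O u)
  have h0 : τ (nrd (unitVal O u)) ≠ 0 :=
    (map_ne_zero τ).mpr (nrd_map_ne_zero (unitVal O) u)
  exact lt_of_le_of_ne (by nlinarith [sq_nonneg (τ (trd (unitVal O u)))]) h0.symm

variable (hO : IsOrder F O)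
include hO

theorem IsOrder.exists_nrd_eq (u : (↥O)ˣ) :
    ∃ n : (𝓞 F)ˣ, algebraMap (𝓞 F) F ↑n = nrd (unitVal O u) := by
  refine exists_unit_eq (isIntegral_trd_and_nrd (hO.isIntegral (u : ↥O).2)).2
    (isIntegral_trd_and_nrd (hO.isIntegral ((u⁻¹ : (↥O)ˣ) : ↥O).2)).2 ?_
  rw [← nrd_mul]
  change nrd (unitVal O u * unitVal O u⁻¹) = 1
  rw [← map_mul, mul_inv_cancel, map_one, nrd_one]

theorem IsOrder.exists_unit_of_eq_algebraMap {u : (↥O)ˣ} {c : F}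
    (hc : unitVal O u = algebraMap F _ c) : ∃ r : (𝓞 F)ˣ, algebraMap (𝓞 F) F ↑r = c := by
  have hK : Function.Injective (algebraMap F ℍ[F, A, B]) := (algebraMap F _).injective
  have hu : unitVal O u * unitVal O u⁻¹ = 1 := by rw [← map_mul, mul_inv_cancel, map_one]
  have hc0 : c ≠ 0 := by
    rintro rfl
    rw [hc, map_zero, zero_mul] at hu
    exact zero_ne_one hu
  have hc' : unitVal O u⁻¹ = algebraMap F _ c⁻¹ := by
    calc unitVal O u⁻¹ = algebraMap F _ c⁻¹ * algebraMap F _ c * unitVal O u⁻¹ := by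
          rw [← map_mul, inv_mul_cancel₀ hc0, map_one, one_mul]
      _ = algebraMap F _ c⁻¹ := by rw [← hc, mul_assoc, hu, mul_one]
  refine exists_unit_eq (y := c⁻¹) ?_ ?_ (mul_inv_cancel₀ hc0)
  · rw [← isIntegral_algebraMap_iff hK, ← hc]
    exact hO.isIntegral (u : ↥O).2
  · rw [← isIntegral_algebraMap_iff hK, ← hc']
    exact hO.isIntegral ((u⁻¹ : (↥O)ˣ) : ↥O).2

theorem IsOrder.isIntegral_trd_sq_div_nrd (u : (↥O)ˣ) :
    IsIntegral ℤ (trd (unitVal O u) ^ 2 / nrd (unitVal O u)) := by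
  have h : nrd (unitVal O u) * nrd (unitVal O u⁻¹) = 1 := by
    rw [← nrd_mul, ← map_mul, mul_inv_cancel, map_one, nrd_one]
  rw [div_eq_mul_inv, inv_eq_of_mul_eq_one_right h]
  exact ((isIntegral_trd_and_nrd (hO.isIntegral (u : ↥O).2)).1.pow 2).mul
    (isIntegral_trd_and_nrd (hO.isIntegral ((u⁻¹ : (↥O)ˣ) : ↥O).2)).2

end OrderUnits

section CyclicUnits

variable {F} {A B : F} {O : Subring ℍ[F, A, B]} (hO : IsOrder F O)
  {d : ℕ} (hd : 6 ≤ d) (hdsf : Squarefree d) {sqrtd : F} (hsqrtd : sqrtd ^ 2 = (d : F))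
  (hgen : Algebra.adjoin ℚ {sqrtd} = ⊤) (σ : F →+* ℝ)
  (hdef : ∀ τ : F →+* ℝ, τ A < 0 ∧ τ B < 0)
include hO hd hdsf hsqrtd hgen σ hdef

theorem IsOrder.exists_trd_sq_eq (u : (↥O)ˣ) :
    ∃ k : ℕ, k ≤ 4 ∧ trd (unitVal O u) ^ 2 = k * nrd (unitVal O u) := by
  obtain ⟨k, hk4, hk⟩ := eq_natCast_of_isIntegral_of_bounded hd hdsf hsqrtd hgen σ
    (hO.isIntegral_trd_sq_div_nrd u) fun τ => by
      have hpos := nrd_unitVal_pos (hdef τ).1 (hdef τ).2 u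
      rw [map_div₀, map_pow]
      exact ⟨by positivity, (div_le_iff₀ hpos).mpr (trd_sq_le τ (hdef τ).1 (hdef τ).2 _)⟩
  exact ⟨k, hk4, (div_eq_iff (nrd_map_ne_zero (unitVal O) u)).mp hk⟩

theorem IsOrder.redUnitCyclic_of_mul_comm
    (hcomm : ∀ u v : (↥O)ˣ, unitVal O u * unitVal O v = unitVal O v * unitVal O u) :
    RedUnitCyclic F O := by
  obtain ⟨g, hg⟩ := exists_generator_of_mul_comm (unitVal O) σ (hdef σ).1 (hdef σ).2
    (hO.exists_trd_sq_eq hd hdsf hsqrtd hgen σ hdef) hcomm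
  refine ⟨g, fun u => ?_⟩
  obtain ⟨n, c, hc⟩ := hg u
  obtain ⟨r, rfl⟩ := hO.exists_unit_of_eq_algebraMap (u := u * (g ^ n)⁻¹) (c := c) (by
    rw [map_mul, hc, mul_assoc, ← map_mul, mul_inv_cancel, map_one, mul_one])
  exact ⟨n, r, hc⟩

end CyclicUnits

section Ramification

open IsDedekindDomain

variable {F}

theorem not_hasAnticommutingPair_of_ramified (v : HeightOneSpectrum (𝓞 F))
    (h2 : (2 : 𝓞 F) ∉ v.asIdeal) {A B : F}
    (hdiv : ∀ x : ℍ[v.adicCompletion F, algebraMap F (v.adicCompletion F) A,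
      algebraMap F (v.adicCompletion F) B], x ≠ 0 → IsUnit x)
    {a b : 𝓞 F} (ha : a ∉ v.asIdeal) (hb : b ∉ v.asIdeal) :
    ¬HasAnticommutingPair (algebraMap (𝓞 F) F a) (algebraMap (𝓞 F) F b) ℍ[F, A, B] := by
  have : CharZero (v.adicCompletion F) :=
    charZero_of_injective_algebraMap (algebraMap F (v.adicCompletion F)).injective
  have hne : ∀ {c : 𝓞 F}, c ∉ v.asIdeal → algebraMap (𝓞 F) F c ≠ 0 := fun hc h0 => by
    rw [(map_eq_zero_iff _ (FaithfulSMul.algebraMap_injective (𝓞 F) F)).mp h0] at hc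
    exact hc v.asIdeal.zero_mem
  exact not_hasAnticommutingPair_of_isUnit (hne ha) (hne hb) (exists_adicCompletion_sq_eq v h2 ha hb)
    hdiv

end Ramification

/-- **Quaternion algebras all of whose orders have cyclic reduced unit groups.** -/
theorem redUnit_cyclic_of_not_isomorphic
    (d : ℕ) (hd6 : 6 ≤ d) (hdsf : Squarefree d)
    (sqrtd : F) (hsqrtd : sqrtd ^ 2 = (d : F))
    (hgen : Algebra.adjoin ℚ {sqrtd} = ⊤)
    (σ₀ : F →+* ℝ) (hσ₀ : 0 < σ₀ sqrtd)
    -- `ε` is the fundamental unit of `F`: the smallest unit greater than `1`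
    (ε : (𝓞 F)ˣ) (hε : 1 < σ₀ (algebraMap (𝓞 F) F ↑ε))
    (hεfund : ∀ u : (𝓞 F)ˣ, 1 < σ₀ (algebraMap (𝓞 F) F ↑u) →
      σ₀ (algebraMap (𝓞 F) F ↑ε) ≤ σ₀ (algebraMap (𝓞 F) F ↑u))
    -- `H = ℍ[F, A, B]` is a totally definite quaternion `F`-algebra (every totally
    -- definite quaternion algebra admits such a presentation)
    (A B : F) (hdef : ∀ σ : F →+* ℝ, σ A < 0 ∧ σ B < 0) :
    -- if `H` is not isomorphic to `(−1,−1/F)`, `(−1,−3/F)`, `(−1,−ε/F)`, `(−ε,−3/F)`,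
    -- then every `O_F`-order in `H` has a cyclic reduced unit group
    (¬Nonempty (ℍ[F, A, B] ≃ₐ[F] ℍ[F, -1, -1]) ∧
        ¬Nonempty (ℍ[F, A, B] ≃ₐ[F] ℍ[F, -1, -3]) ∧
        ¬Nonempty (ℍ[F, A, B] ≃ₐ[F] ℍ[F, -1, -(algebraMap (𝓞 F) F ↑ε)]) ∧
        ¬Nonempty (ℍ[F, A, B] ≃ₐ[F] ℍ[F, -(algebraMap (𝓞 F) F ↑ε), -3]) →
      ∀ O : Subring ℍ[F, A, B], IsOrder F O → RedUnitCyclic F O) ∧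
    -- in particular, this holds whenever the discriminant of `H` does not divide
    -- `6 O_F`, i.e. whenever some finite place not dividing `6` is ramified in `H`
    ((∃ v : IsDedekindDomain.HeightOneSpectrum (𝓞 F), (6 : 𝓞 F) ∉ v.asIdeal ∧
        ∀ x : ℍ[v.adicCompletion F, algebraMap F (v.adicCompletion F) A,
            algebraMap F (v.adicCompletion F) B], x ≠ 0 → IsUnit x) →
      ∀ O : Subring ℍ[F, A, B], IsOrder F O → RedUnitCyclic F O) := by
  have main : ¬Nonempty (ℍ[F, A, B] ≃ₐ[F] ℍ[F, -1, -1]) ∧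
        ¬Nonempty (ℍ[F, A, B] ≃ₐ[F] ℍ[F, -1, -3]) ∧
        ¬Nonempty (ℍ[F, A, B] ≃ₐ[F] ℍ[F, -1, -(algebraMap (𝓞 F) F ↑ε)]) ∧
        ¬Nonempty (ℍ[F, A, B] ≃ₐ[F] ℍ[F, -(algebraMap (𝓞 F) F ↑ε), -3]) →
      ∀ O : Subring ℍ[F, A, B], IsOrder F O → RedUnitCyclic F O := by
    rintro ⟨h11, h13, h1ε, hε3⟩ O hO
    set e := algebraMap (𝓞 F) F ↑ε
    have he : 0 < σ₀ e := one_pos.trans hε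
    have he0 : e ≠ 0 := (map_ne_zero σ₀).mp he.ne'
    have hneg1 : σ₀ (-1) < 0 := by simp
    have hnege : σ₀ (-e) < 0 := by simpa using he
    have hneg3 : σ₀ (-3) < 0 := by rw [map_neg, map_ofNat]; norm_num
    have p11 := mt (nonempty_algEquiv_of_hasAnticommutingPair (A := A) (B := B) σ₀ hneg1 hneg1) h11
    have p13 := mt (nonempty_algEquiv_of_hasAnticommutingPair (A := A) (B := B) σ₀ hneg1 hneg3) h13
    have p1ε := mt (nonempty_algEquiv_of_hasAnticommutingPair (A := A) (B := B) σ₀ hneg1 hnege) h1ε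
    have pε3 := mt (nonempty_algEquiv_of_hasAnticommutingPair (A := A) (B := B) σ₀ hnege hneg3) hε3
    have hnrd : ∀ u : (↥O)ˣ, ∃ w : F, w ≠ 0 ∧
        (-nrd (unitVal O u) = -1 * w ^ 2 ∨ -nrd (unitVal O u) = -e * w ^ 2) := by
      intro u
      obtain ⟨n, hn⟩ := hO.exists_nrd_eq u
      obtain ⟨w, hw, h⟩ := exists_eq_sq_or_eq_mul_sq hε hεfund n
        (hn ▸ nrd_unitVal_pos (hdef σ₀).1 (hdef σ₀).2 u)
      refine ⟨w, hw, ?_⟩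
      rw [← hn, neg_mul, neg_mul, neg_inj, neg_inj]
      exact h
    refine hO.redUnitCyclic_of_mul_comm hd6 hdsf hsqrtd hgen σ₀ hdef
      (mul_comm_of_not_hasAnticommutingPair (unitVal O) σ₀ (hdef σ₀).1 (hdef σ₀).2
        (hO.exists_trd_sq_eq hd6 hdsf hsqrtd hgen σ₀ hdef) (fun u v h => ?_) fun u h => ?_)
    · obtain ⟨x, hx, hu⟩ := hnrd u
      obtain ⟨y, hy, hv⟩ := hnrd v
      rcases hu with hu | hu <;> rcases hv with hv | hv <;> rw [hu, hv] at h <;>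
        replace h := h.of_mul_sq hx hy
      · exact p11 h
      · exact p1ε h
      · exact p1ε h.symm
      · exact p1ε (h.neg_one_of_self he0)
    · obtain ⟨x, hx, hu⟩ := hnrd u
      rw [← mul_one (-3 : F), ← one_pow (M := F) 2] at h
      rcases hu with hu | hu <;> rw [hu] at h <;> replace h := h.of_mul_sq hx one_ne_zero
      · exact p13 h
      · exact pε3 h
  refine ⟨main, fun ⟨v, h6, hdiv⟩ => main ?_⟩
  have h2 : (2 : 𝓞 F) ∉ v.asIdeal := fun h => h6 (by
    rw [show (6 : 𝓞 F) = 3 * 2 by norm_num]; exact v.asIdeal.mul_mem_left _ h)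
  have h3 : (-3 : 𝓞 F) ∉ v.asIdeal := fun h => h6 (by
    rw [show (6 : 𝓞 F) = -2 * -3 by norm_num]; exact v.asIdeal.mul_mem_left _ h)
  have hunit : ∀ u : (𝓞 F)ˣ, (u : 𝓞 F) ∉ v.asIdeal := fun u h =>
    v.isPrime.ne_top (Ideal.eq_top_of_isUnit_mem _ h u.isUnit)
  have key : ∀ {a b : 𝓞 F}, a ∉ v.asIdeal → b ∉ v.asIdeal → ∀ {a' b' : F},
      algebraMap (𝓞 F) F a = a' → algebraMap (𝓞 F) F b = b' →
      ¬Nonempty (ℍ[F, A, B] ≃ₐ[F] ℍ[F, a', b']) := by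
    rintro a b ha hb _ _ rfl rfl ⟨φ⟩
    exact not_hasAnticommutingPair_of_ramified v h2 hdiv ha hb (hasAnticommutingPair_of_algEquiv φ)
  exact ⟨key (hunit (-1)) (hunit (-1)) (by simp) (by simp),
    key (hunit (-1)) h3 (by simp) (by rw [map_neg, map_ofNat]),
    key (hunit (-1)) (hunit (-ε)) (by simp) (by simp),
    key (hunit (-ε)) h3 (by simp) (by rw [map_neg, map_ofNat])⟩

end QuatPaper
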